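/- arXiv:2003.05412 — 2 statements merged into one kernel-verified Lean document; each statement's English description precedes it below -/
import Mathlib

section
/- Suppose there exists z₀ ∈ ϱ(H_T) such that Σ̂Ĝ_{z₀} has a bounded inverse in B(𝔉). Then Ĥ_T := S^×_T is self-adjoint, with dom(Ĥ_T) = {ψ ∈ dom(T) : ψ − Gψ ∈ 𝔥₁} and dom(H) ∩ dom(Ĥ_T) = {0}. Moreover, Σ̂Ĝ_z has a bounded inverse for every z ∈ ϱ(H_T) ∩ ϱ(Ĥ_T), and (−Ĥ_T + z)⁻¹ = (−H_T + z)⁻¹ − Ĝ_z(Σ̂Ĝ_z)⁻¹Ĝ*_{z̄}. Furthermore, for every z ∈ ϱ(H) ∩ ϱ(H_T) ∩ ϱ(Ĥ_T), the block operator matrix [[A_TG_z, G*_{z̄} − 1],[G_z − 1, R_z]] (with domain dom(T) ⊕ 𝔉 in 𝔉 ⊕ 𝔉) has a bounded inverse 𝕄_z on 𝔉 ⊕ 𝔉, and (−Ĥ_T + z)⁻¹ = R_z − [G_z, R_z] 𝕄_z [G*_{z̄}; R_z]. -/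
noncomputable section

open scoped ComplexInnerProductSpace
open ContinuousLinearMap Filter

variable {F X : Type*}
  [NormedAddCommGroup F] [InnerProductSpace ℂ F] [CompleteSpace F]
  [NormedAddCommGroup X] [InnerProductSpace ℂ X] [CompleteSpace X]

/-- `W R l z = 1 + (z - l) • R`; the point `z` belongs to the resolvent set of the
self-adjoint operator `H` iff `W R l z` is boundedly invertible, where
`R = (-H + λ₀)⁻¹` and `l = λ₀ ∈ ϱ(H) ∩ ℝ` encode `H`. -/
def W (R : F →L[ℂ] F) (l : ℝ) (z : ℂ) : F →L[ℂ] F := 1 + (z - (l : ℂ)) • R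

/-- The resolvent set `ϱ(H)` of `H`, encoded through `R = (-H + λ₀)⁻¹`. -/
def res (R : F →L[ℂ] F) (l : ℝ) : Set ℂ := {z | IsUnit (W R l z)}

/-- The resolvent `R_z = (-H + z)⁻¹`. -/
def Rz (R : F →L[ℂ] F) (l : ℝ) (z : ℂ) : F →L[ℂ] F := R ∘L Ring.inverse (W R l z)

/-- `G_z = (Σ R_z̄)*`, where the bounded operator `B = Σ ∘ R : 𝔉 →L 𝔛` encodes the
(graph-norm bounded) operator `Σ : 𝔥₁ → 𝔛`. -/
def Gz (R : F →L[ℂ] F) (B : F →L[ℂ] X) (l : ℝ) (z : ℂ) : X →L[ℂ] F :=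
  adjoint (B ∘L Ring.inverse (W R l (starRingEnd ℂ z)))

/-- `(-H + λ₀) ψ`, for `ψ ∈ dom H = ran R`. -/
def Hinv (R : F →L[ℂ] F) (ψ : F) : F := Function.invFun (⇑R) ψ

/-- `Σ ψ`, for `ψ ∈ dom H = ran R`. -/
def SigmaOf (R : F →L[ℂ] F) (B : F →L[ℂ] X) (ψ : F) : X := B (Hinv R ψ)

/-- `Q` is the resolvent `(-K + z)⁻¹` of the (in general unbounded) operator `K`. -/
def IsResolventAt (K : F →ₗ.[ℂ] F) (z : ℂ) (Q : F →L[ℂ] F) : Prop :=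
  (∀ ψ : F, Q ψ ∈ K.domain) ∧
  (∀ (ψ : F) (h : Q ψ ∈ K.domain), z • Q ψ - K ⟨Q ψ, h⟩ = ψ) ∧
  (∀ ψ : K.domain, Q (z • (ψ : F) - K ψ) = (ψ : F))

/-- The resolvent set of the (in general unbounded) operator `K`. -/
def pres (K : F →ₗ.[ℂ] F) : Set ℂ := {z | ∃ Q : F →L[ℂ] F, IsResolventAt K z Q}

/-- `A_* ψ`: the (for `ψ ∈ dom S^×` unique) `φ` with `ψ - G φ ∈ 𝔥₁ = ran R`. -/
def Astar (R B : F →L[ℂ] F) (l : ℝ) (ψ : F) : F :=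
  Classical.epsilon fun φ : F => ψ - Gz R B l l φ ∈ Set.range ⇑R

/-- `Σ̂ ψ = (1 - A_*) ψ`. -/
def SigmaHat (R B : F →L[ℂ] F) (l : ℝ) (ψ : F) : F := ψ - Astar R B l ψ

/-- `A₀ ψ = A ψ₀`, where `ψ₀ = ψ - G (A_* ψ)`. -/
def Azero (R B : F →L[ℂ] F) (l : ℝ) (ψ : F) : F :=
  B (Hinv R (ψ - Gz R B l l (Astar R B l ψ)))

/-- `S^× ψ = λ₀ ψ - (-H + λ₀) ψ₀`, where `ψ₀ = ψ - G (A_* ψ)`. -/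
def SxFun (R B : F →L[ℂ] F) (l : ℝ) (ψ : F) : F :=
  (l : ℂ) • ψ - Hinv R (ψ - Gz R B l l (Astar R B l ψ))

/-- `K ∈ B(𝔉)` is a two-sided bounded inverse of `A_T G_z = T - A (G - G_z)`
(with domain `dom T`). -/
def IsInvATG (R B : F →L[ℂ] F) (l : ℝ) (T : F →ₗ.[ℂ] F) (z : ℂ)
    (K : F →L[ℂ] F) : Prop :=
  (∀ y : F, K y ∈ T.domain) ∧
  (∀ (y : F) (h : K y ∈ T.domain),
    T ⟨K y, h⟩ - SigmaOf R B ((Gz R B l l - Gz R B l z) (K y)) = y) ∧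
  (∀ x : T.domain,
    K (T x - SigmaOf R B ((Gz R B l l - Gz R B l z) (x : F))) = (x : F))

set_option linter.unusedSectionVars false

/-- An everywhere defined map with an everywhere defined formal adjoint is linear and bounded. -/
theorem exists_clm_of_formalAdjoint {f g : F → F} (h : ∀ x y, ⟪f x, y⟫ = ⟪x, g y⟫) :
    ∃ f' : F →L[ℂ] F, ∀ x, f' x = f x := by
  let f₀ : F →ₗ[ℂ] F :=
    { toFun := f
      map_add' := fun x y => ext_inner_right ℂ fun v => by
        rw [inner_add_left, h, h, h, inner_add_left]
      map_smul' := fun c x => ext_inner_right ℂ fun v => by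
        rw [RingHom.id_apply, inner_smul_left, h, h, inner_smul_left] }
  refine ⟨ContinuousLinearMap.ofSeqClosedGraph (g := f₀) ?_, fun x => rfl⟩
  intro u x y hx hy
  refine ext_inner_right ℂ fun v => ?_
  have h₁ : Tendsto (fun n => ⟪u n, g v⟫) atTop (nhds ⟪x, g v⟫) := hx.inner tendsto_const_nhds
  have h₂ : Tendsto (fun n => ⟪f (u n), v⟫) atTop (nhds ⟪y, v⟫) := hy.inner tendsto_const_nhds
  simp only [h] at h₂
  rw [tendsto_nhds_unique h₂ h₁]
  exact (h x v).symm

section Resolvent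

variable {K : F →ₗ.[ℂ] F} {z : ℂ} {P Q : F →L[ℂ] F}

theorem IsResolventAt.eq (hP : IsResolventAt K z P) (hQ : IsResolventAt K z Q) : P = Q := by
  ext ψ
  have h := hP.2.2 ⟨Q ψ, hQ.1 ψ⟩
  rwa [hQ.2.1] at h

theorem IsSelfAdjoint.inner_apply_left (hK : IsSelfAdjoint K) (x y : K.domain) :
    ⟪K x, (y : F)⟫ = ⟪(x : F), K y⟫ := by
  have h := LinearPMap.adjoint_isFormalAdjoint hK.dense_domain
  rw [LinearPMap.isSelfAdjoint_def.mp hK] at h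
  exact h x y

theorem IsResolventAt.conj_adjoint (hK : IsSelfAdjoint K) (hQ : IsResolventAt K z Q) :
    IsResolventAt K (starRingEnd ℂ z) (adjoint Q) := by
  have key : ∀ (y : F) (x : K.domain),
      ⟪(starRingEnd ℂ z) • adjoint Q y - y, (x : F)⟫ = ⟪adjoint Q y, K x⟫ := by
    intro y x
    have h := hQ.2.2 x
    rw [map_sub, map_smul, sub_eq_iff_eq_add] at h
    rw [adjoint_inner_left, inner_sub_left, inner_smul_left, adjoint_inner_left,
      Complex.conj_conj, ← inner_smul_right, h, inner_add_right]
    ring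
  have hmem : ∀ y, adjoint Q y ∈ K.domain := by
    intro y
    have h := LinearPMap.mem_adjoint_domain_of_exists (T := K) (adjoint Q y) ⟨_, key y⟩
    rwa [LinearPMap.isSelfAdjoint_def.mp hK] at h
  refine ⟨hmem, fun y hy => ?_, fun x => ?_⟩
  · refine hK.dense_domain.eq_of_inner_left ℂ fun v hv => ?_
    have h := hK.inner_apply_left ⟨_, hy⟩ ⟨v, hv⟩
    have h' := key y ⟨v, hv⟩
    simp only at h h'
    rw [inner_sub_left, h, ← h', inner_sub_left]
    ring
  · refine ext_inner_right ℂ fun v => ?_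
    rw [adjoint_inner_left, inner_sub_left, inner_smul_left, Complex.conj_conj,
      hK.inner_apply_left x ⟨Q v, hQ.1 v⟩, ← inner_smul_right, ← inner_sub_right, hQ.2.1]

theorem conj_mem_pres (hK : IsSelfAdjoint K) (hz : z ∈ pres K) : starRingEnd ℂ z ∈ pres K := by
  obtain ⟨Q, hQ⟩ := hz
  exact ⟨_, hQ.conj_adjoint hK⟩

theorem isSelfAdjoint_of_symmetric_of_isResolventAt
    (hsym : ∀ x y : K.domain, ⟪K x, (y : F)⟫ = ⟪(x : F), K y⟫)
    (hP : IsResolventAt K z P) (hQ : IsResolventAt K (starRingEnd ℂ z) Q) :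
    IsSelfAdjoint K := by
  have hdense : Dense (K.domain : Set F) := by
    rw [Submodule.dense_iff_topologicalClosure_eq_top,
      Submodule.topologicalClosure_eq_top_iff, Submodule.eq_bot_iff]
    intro v hv
    rw [Submodule.mem_orthogonal] at hv
    have hu : P v = 0 := by
      refine ext_inner_left ℂ fun w => ?_
      have h := hv _ (hQ.1 w)
      rw [← hP.2.1 v (hP.1 v), inner_sub_right, inner_smul_right,
        ← hsym ⟨_, hQ.1 w⟩ ⟨_, hP.1 v⟩] at h
      have h' := hQ.2.1 w (hQ.1 w)
      rw [inner_zero_right, ← h', inner_sub_left, inner_smul_left, Complex.conj_conj]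
      exact h
    have h := hP.2.1 v (hP.1 v)
    have h0 : (⟨P v, hP.1 v⟩ : K.domain) = 0 := Subtype.ext hu
    rw [h0, hu] at h
    simpa using h.symm
  have hle : K ≤ K.adjoint := LinearPMap.IsFormalAdjoint.le_adjoint hdense hsym
  rw [LinearPMap.isSelfAdjoint_def]
  refine (LinearPMap.eq_of_le_of_domain_eq hle (le_antisymm hle.1 fun y hy => ?_)).symm
  suffices h : y = P (z • y - K.adjoint ⟨y, hy⟩) by rw [h]; exact hP.1 _
  set u := P (z • y - K.adjoint ⟨y, hy⟩) with hu
  have hu₁ := hP.2.1 _ (hP.1 (z • y - K.adjoint ⟨y, hy⟩))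
  refine ext_inner_right ℂ fun w => ?_
  have hw := hQ.2.1 w (hQ.1 w)
  have hy' := LinearPMap.adjoint_isFormalAdjoint hdense ⟨y, hy⟩ ⟨_, hQ.1 w⟩
  have hu' := hsym ⟨_, hP.1 (z • y - K.adjoint ⟨y, hy⟩)⟩ ⟨_, hQ.1 w⟩
  have h₁ := congrArg (fun t => ⟪t, Q w⟫) hu₁
  simp only [inner_sub_left, inner_smul_left, ← hu] at h₁ hu' hy'
  rw [← hw, inner_sub_right, inner_sub_right, inner_smul_right, inner_smul_right]
  linear_combination -h₁ - hu' + hy'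

end Resolvent

section Triple

variable {D : Type*} [AddCommGroup D] [Module ℂ D]

/-- `K` is the operator `ι d ↦ L d` with domain `ι (ker b)`. -/
structure IsRestriction (ι L b : D →ₗ[ℂ] F) (K : F →ₗ.[ℂ] F) : Prop where
  mem_iff : ∀ x, x ∈ K.domain ↔ ∃ d, b d = 0 ∧ ι d = x
  apply_eq : ∀ d (h : ι d ∈ K.domain), b d = 0 → K ⟨ι d, h⟩ = L d

/-- `g φ` solves `L d = z d` with boundary value `a d = φ`. -/
def IsGammaField (ι L a : D →ₗ[ℂ] F) (z : ℂ) (g : F → F) : Prop :=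
  ∀ φ, ∃ d, a d = φ ∧ L d = z • ι d ∧ ι d = g φ

theorem exists_isRestriction {ι : D →ₗ[ℂ] F} (hι : Function.Injective ι) (L b : D →ₗ[ℂ] F) :
    ∃ K, IsRestriction ι L b K := by
  refine ⟨{ domain := (LinearMap.ker b).map ι
            toFun := L ∘ₗ (LinearMap.ker b).subtype ∘ₗ
              (Submodule.equivMapOfInjective ι hι (LinearMap.ker b)).symm.toLinearMap },
    fun x => by simp, fun d h hd => ?_⟩
  simp only [LinearPMap.mk_apply, LinearMap.coe_comp, Function.comp_apply,
    LinearEquiv.coe_coe, Submodule.coe_subtype]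
  congr 1
  exact hι (Submodule.map_equivMapOfInjective_symm_apply ι hι _ ⟨ι d, h⟩)

variable {ι L a s b : D →ₗ[ℂ] F} {K HT Hh : F →ₗ.[ℂ] F} {z : ℂ} {g g' : F → F} {σ : F → F}

theorem IsRestriction.isResolventAt_iff (hK : IsRestriction ι L b K) {Q : F →L[ℂ] F} :
    IsResolventAt K z Q ↔
      (∀ ψ, ∃ d, b d = 0 ∧ ι d = Q ψ ∧ z • ι d - L d = ψ) ∧
      (∀ d, b d = 0 → Q (z • ι d - L d) = ι d) := by
  constructor
  · rintro ⟨h₁, h₂, h₃⟩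
    refine ⟨fun ψ => ?_, fun d hd => ?_⟩
    · obtain ⟨d, hd, hdQ⟩ := (hK.mem_iff _).1 (h₁ ψ)
      have hm : ι d ∈ K.domain := (hK.mem_iff _).2 ⟨d, hd, rfl⟩
      refine ⟨d, hd, hdQ, ?_⟩
      have h := h₂ ψ (h₁ ψ)
      simp only [← hdQ] at h
      rwa [hK.apply_eq d hm hd] at h
    · have hm : ι d ∈ K.domain := (hK.mem_iff _).2 ⟨d, hd, rfl⟩
      have h := h₃ ⟨ι d, hm⟩
      rwa [hK.apply_eq d hm hd] at h
  · rintro ⟨h₁, h₂⟩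
    have hm : ∀ ψ, Q ψ ∈ K.domain := fun ψ => by
      obtain ⟨d, hd, hdQ, -⟩ := h₁ ψ
      exact (hK.mem_iff _).2 ⟨d, hd, hdQ⟩
    refine ⟨hm, fun ψ h => ?_, fun ψ => ?_⟩
    · obtain ⟨d, hd, hdQ, hdz⟩ := h₁ ψ
      simp only [← hdQ] at h ⊢
      rw [hK.apply_eq d h hd, hdz]
    · obtain ⟨x, hx⟩ := ψ
      obtain ⟨d, hd, rfl⟩ := (hK.mem_iff _).1 hx
      rw [hK.apply_eq d hx hd]
      exact h₂ d hd

theorem krein_isResolventAt (ht : IsRestriction ι L a HT) (hh : IsRestriction ι L s Hh)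
    (hσ : ∀ d, σ (ι d) = s d) {G Q V C : F →L[ℂ] F} (hg : IsGammaField ι L a z G)
    (hQ : IsResolventAt HT z Q) (hV : ∀ ψ, V (σ (G ψ)) = ψ) (hV' : ∀ ψ, σ (G (V ψ)) = ψ)
    (hC : ∀ ψ, C ψ = σ (Q ψ)) :
    IsResolventAt Hh z (Q - G ∘L V ∘L C) := by
  obtain ⟨hQ₁, hQ₂⟩ := ht.isResolventAt_iff.1 hQ
  refine hh.isResolventAt_iff.2 ⟨fun ψ => ?_, fun d hd => ?_⟩
  · obtain ⟨d₁, ha₁, hi₁, hz₁⟩ := hQ₁ ψ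
    obtain ⟨d₂, ha₂, hL₂, hi₂⟩ := hg (V (C ψ))
    refine ⟨d₁ - d₂, ?_, ?_, ?_⟩
    · rw [map_sub, ← hσ, ← hσ, hi₁, hi₂, hV', hC, sub_self]
    · simp [hi₁, hi₂]
    · rw [map_sub, map_sub, hL₂, smul_sub, sub_sub_sub_cancel_right, hz₁]
  · obtain ⟨d₂, ha₂, hL₂, hi₂⟩ := hg (a d)
    have hf : z • ι d - L d = z • ι (d - d₂) - L (d - d₂) := by
      rw [map_sub, map_sub, hL₂, smul_sub, sub_sub_sub_cancel_right]
    have hQd := hQ₂ (d - d₂) (by rw [map_sub, ha₂, sub_self])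
    rw [← hf] at hQd
    have hCd : C (z • ι d - L d) = - s d₂ := by
      rw [hC, hQd, hσ, map_sub, hd, zero_sub]
    have hVd : V (s d₂) = a d := by rw [← hσ, hi₂, hV]
    rw [sub_apply, comp_apply, comp_apply, hCd, map_neg, hVd, map_neg, hQd, ← hi₂, map_sub,
      sub_neg_eq_add, sub_add_cancel]

theorem inner_gammaField_comm
    (green : ∀ u v, ⟪L u, ι v⟫ - ⟪ι u, L v⟫ = ⟪a u, s v⟫ - ⟪s u, a v⟫)
    (hσ : ∀ d, σ (ι d) = s d) (hg : IsGammaField ι L a z g)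
    (hg' : IsGammaField ι L a (starRingEnd ℂ z) g') (φ φ' : F) :
    ⟪σ (g φ), φ'⟫ = ⟪φ, σ (g' φ')⟫ := by
  obtain ⟨d, ha, hL, hi⟩ := hg φ
  obtain ⟨d', ha', hL', hi'⟩ := hg' φ'
  have h := green d d'
  rw [hL, hL', ha, ha', inner_smul_left, inner_smul_right, sub_self] at h
  rw [← hi, ← hi', hσ, hσ]
  exact (sub_eq_zero.1 h.symm).symm

theorem bijective_gammaField (ht : IsRestriction ι L a HT)
    (hh : IsRestriction ι L s Hh)
    (hι : Function.Injective ι)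
    (hσ : ∀ d, σ (ι d) = s d) (hg : IsGammaField ι L a z g)
    (hs : Function.Surjective s) {P Q : F →L[ℂ] F} (hP : IsResolventAt HT z P)
    (hQ : IsResolventAt Hh z Q) :
    Function.Bijective fun φ => σ (g φ) := by
  obtain ⟨hQ₁, hQ₂⟩ := hh.isResolventAt_iff.1 hQ
  constructor
  · intro φ φ' h
    obtain ⟨d, ha, hL, hi⟩ := hg φ
    obtain ⟨d', ha', hL', hi'⟩ := hg φ'
    simp only [← hi, ← hi', hσ] at h
    have h0 := hQ₂ (d - d') (by rw [map_sub, h, sub_self])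
    rw [map_sub ι, map_sub L, hL, hL', smul_sub, sub_self, map_zero, ← map_sub] at h0
    have : d - d' = 0 := hι (by rw [map_zero, h0])
    rw [← ha, ← ha', sub_eq_zero.1 this]
  · intro y
    obtain ⟨v, rfl⟩ := hs y
    obtain ⟨d, hd, -, hdz⟩ := hQ₁ (z • ι v - L v)
    obtain ⟨e, ha, hL, hi⟩ := hg (a (v - d))
    have hker : L (v - d) = z • ι (v - d) := by
      rw [map_sub, map_sub, smul_sub]
      rw [sub_eq_iff_eq_add] at hdz
      rw [hdz]
      abel
    have hT0 := (ht.isResolventAt_iff.1 hP).2 (v - d - e) (by rw [map_sub, ha, sub_self])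
    rw [map_sub ι, map_sub L, hker, hL, smul_sub, sub_self, map_zero, ← map_sub] at hT0
    have : v - d - e = 0 := hι (by rw [map_zero, hT0])
    refine ⟨a (v - d), ?_⟩
    simp only
    rw [← hi, hσ, ← sub_eq_zero.1 this, map_sub, hd, sub_zero]

theorem eq_gammaField
    (green : ∀ u v, ⟪L u, ι v⟫ - ⟪ι u, L v⟫ = ⟪a u, s v⟫ - ⟪s u, a v⟫)
    (hσ : ∀ d, σ (ι d) = s d) (ht : IsRestriction ι L a HT)
    {P : F →L[ℂ] F} (hP : IsResolventAt HT (starRingEnd ℂ z) P)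
    (hg : ∀ φ ψ, ⟪g φ, ψ⟫ = ⟪φ, σ (P ψ)⟫) {φ : F} {d : D} (ha : a d = φ)
    (hL : L d = z • ι d) : ι d = g φ := by
  refine ext_inner_right ℂ fun ψ => ?_
  obtain ⟨u, hau, hu, hzu⟩ := (ht.isResolventAt_iff.1 hP).1 ψ
  have h := green d u
  rw [hL, ha, hau, inner_zero_right, inner_smul_left, sub_zero] at h
  rw [hg, ← hu, hσ, ← h, ← hzu, inner_sub_right, inner_smul_right]

theorem exists_solution_of_gammaField
    (ht : IsRestriction ι L a HT) {w : ℂ} (hg : IsGammaField ι L a w g)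
    {Q : F →L[ℂ] F} (hQ : IsResolventAt HT z Q) (φ : F) :
    ∃ d, a d = φ ∧ L d = z • ι d := by
  obtain ⟨d, ha, hL, -⟩ := hg φ
  obtain ⟨u, hau, -, hzu⟩ := (ht.isResolventAt_iff.1 hQ).1 (ι d)
  refine ⟨d + (w - z) • u, by simp [ha, hau], ?_⟩
  have hLu : L u = z • ι u - ι d := by rw [← hzu]; abel
  rw [map_add, map_add, map_smul, map_smul, hL, hLu]
  module

end Triple

section Coordinates

variable (R B : F →L[ℂ] F) (l : ℝ) (T : F →ₗ.[ℂ] F)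

/-- The element `R χ + G φ` of `dom S^×` with coordinates `(χ, φ)`. -/
def embed : F × T.domain →ₗ[ℂ] F :=
  R.toLinearMap ∘ₗ LinearMap.fst ℂ F T.domain +
    (adjoint B).toLinearMap ∘ₗ T.domain.subtype ∘ₗ LinearMap.snd ℂ F T.domain

/-- `A_T` in the coordinates `(χ, φ)`. -/
def traceT : F × T.domain →ₗ[ℂ] F :=
  B.toLinearMap ∘ₗ LinearMap.fst ℂ F T.domain + T.toFun ∘ₗ LinearMap.snd ℂ F T.domain

/-- `Σ̂` in the coordinates `(χ, φ)`. -/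
def traceHat : F × T.domain →ₗ[ℂ] F :=
  embed R B T - T.domain.subtype ∘ₗ LinearMap.snd ℂ F T.domain

/-- `S^× + A_T` in the coordinates `(χ, φ)`. -/
def action : F × T.domain →ₗ[ℂ] F :=
  (l : ℂ) • embed R B T - LinearMap.fst ℂ F T.domain + traceT B T

@[simp] theorem embed_apply (d : F × T.domain) : embed R B T d = R d.1 + adjoint B (d.2 : F) := rfl

@[simp] theorem traceT_apply (d : F × T.domain) : traceT B T d = B d.1 + T d.2 := rfl

@[simp] theorem traceHat_apply (d : F × T.domain) :
    traceHat R B T d = R d.1 + adjoint B (d.2 : F) - d.2 := rfl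

@[simp] theorem action_apply (d : F × T.domain) :
    action R B l T d = (l : ℂ) • (R d.1 + adjoint B (d.2 : F)) - d.1 + (B d.1 + T d.2) := rfl

variable {R B l T}

theorem green_identity (hR : IsSelfAdjoint R) (hT : IsSelfAdjoint T) (u v : F × T.domain) :
    ⟪action R B l T u, embed R B T v⟫ - ⟪embed R B T u, action R B l T v⟫ =
      ⟪traceT B T u, traceHat R B T v⟫ - ⟪traceHat R B T u, traceT B T v⟫ := by
  have hRs : ∀ x y, ⟪R x, y⟫ = ⟪x, R y⟫ := fun x y => by
    rw [← adjoint_inner_left, ← star_eq_adjoint, hR.star_eq]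
  have hTs := hT.inner_apply_left u.2 v.2
  have h₁ := hRs u.1 v.1
  have h₂ := adjoint_inner_left B v.1 (u.2 : F)
  have h₃ := adjoint_inner_right B u.1 (v.2 : F)
  simp only [action_apply, embed_apply, traceT_apply, traceHat_apply, inner_add_left,
    inner_add_right, inner_sub_left, inner_sub_right, inner_smul_left, inner_smul_right,
    Complex.conj_ofReal, smul_add, h₁, h₂, h₃, hTs]
  ring

theorem Gz_self : Gz R B l l = adjoint B := by
  have h : W R l (starRingEnd ℂ (l : ℂ)) = 1 := by simp [W]
  rw [Gz, h, Ring.inverse_one]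
  rfl

theorem Gz_add (hR : IsSelfAdjoint R) {z : ℂ} (hz : starRingEnd ℂ z ∈ res R l) (φ : F) :
    Gz R B l z φ + (z - l) • R (Gz R B l z φ) = adjoint B φ := by
  have hW : adjoint (W R l (starRingEnd ℂ z)) = W R l z := by
    rw [← star_eq_adjoint]
    simp [W, hR.star_eq]
  have h : W R l z ∘L adjoint (Ring.inverse (W R l (starRingEnd ℂ z))) = 1 := by
    rw [← hW, ← adjoint_comp]
    exact (congrArg adjoint (Ring.inverse_mul_cancel _ hz)).trans (by
      rw [← star_eq_adjoint, star_one])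
  have h' := congrArg (fun f : F →L[ℂ] F => f (adjoint B φ)) h
  simpa [W, Gz, adjoint_comp] using h'

theorem conj_mem_res (hR : IsSelfAdjoint R) {z : ℂ} (hz : z ∈ res R l) :
    starRingEnd ℂ z ∈ res R l := by
  have h : W R l (starRingEnd ℂ z) = star (W R l z) := by simp [W, hR.star_eq]
  change IsUnit _
  rw [h]
  exact IsUnit.star hz

theorem inverse_W_add {z : ℂ} (hz : z ∈ res R l) (φ : F) :
    Ring.inverse (W R l z) φ + (z - l) • R (Ring.inverse (W R l z) φ) = φ := by
  have h := congrArg (fun f : F →L[ℂ] F => f φ) (Ring.mul_inverse_cancel _ hz)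
  simpa [W] using h

theorem adjoint_Gz_conj {z : ℂ} (φ : F) :
    adjoint (Gz R B l (starRingEnd ℂ z)) φ = B (Ring.inverse (W R l z) φ) := by
  simp [Gz]

theorem Hinv_apply (hinj : Function.Injective R) (χ : F) : Hinv R (R χ) = χ :=
  Function.leftInverse_invFun hinj χ

theorem eq_of_sub_mem_range (hkerG : Function.Injective (adjoint B))
    (hranG : Set.range (adjoint B) ∩ Set.range R = {0}) {ψ φ φ' : F}
    (h : ψ - adjoint B φ ∈ Set.range R) (h' : ψ - adjoint B φ' ∈ Set.range R) : φ = φ' := by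
  obtain ⟨x, hx⟩ := h
  obtain ⟨y, hy⟩ := h'
  have hm : adjoint B (φ - φ') ∈ Set.range (adjoint B) ∩ Set.range R :=
    ⟨⟨_, rfl⟩, y - x, by rw [map_sub, map_sub, hx, hy]; abel⟩
  rw [hranG, Set.mem_singleton_iff, map_sub, sub_eq_zero] at hm
  exact hkerG hm

theorem SigmaHat_add (hkerG : Function.Injective (adjoint B))
    (hranG : Set.range (adjoint B) ∩ Set.range R = {0}) (χ φ : F) :
    SigmaHat R B l (R χ + adjoint B φ) = R χ + adjoint B φ - φ := by
  have h : R χ + adjoint B φ - adjoint B φ ∈ Set.range R := ⟨χ, by simp⟩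
  have h' := Classical.epsilon_spec
    (p := fun φ' : F => R χ + adjoint B φ - adjoint B φ' ∈ Set.range R) ⟨_, h⟩
  rw [SigmaHat, Astar, Gz_self, eq_of_sub_mem_range hkerG hranG h' h]

theorem SigmaHat_embed (hkerG : Function.Injective (adjoint B))
    (hranG : Set.range (adjoint B) ∩ Set.range R = {0}) (d : F × T.domain) :
    SigmaHat R B l (embed R B T d) = traceHat R B T d :=
  SigmaHat_add hkerG hranG d.1 d.2

theorem embed_injective (hinj : Function.Injective R) (hkerG : Function.Injective (adjoint B))
    (hranG : Set.range (adjoint B) ∩ Set.range R = {0}) :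
    Function.Injective (embed R B T) := by
  intro d d' h
  have h₂ : (d.2 : F) = d'.2 := eq_of_sub_mem_range (ψ := embed R B T d) hkerG hranG
    ⟨d.1, by simp⟩ ⟨d'.1, by rw [h]; simp⟩
  rw [embed_apply, embed_apply, h₂, add_left_inj] at h
  exact Prod.ext (hinj h) (Subtype.ext h₂)

theorem SigmaOf_Gz_sub (hR : IsSelfAdjoint R) (hinj : Function.Injective R) {z : ℂ}
    (hz : z ∈ res R l) (φ : F) :
    SigmaOf R B ((Gz R B l l - Gz R B l z) φ) = (z - l) • B (Gz R B l z φ) := by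
  have h : (Gz R B l l - Gz R B l z) φ = R ((z - l) • Gz R B l z φ) := by
    rw [sub_apply, Gz_self, ← Gz_add hR (conj_mem_res hR hz), map_smul]
    abel
  rw [h, SigmaOf, Hinv_apply hinj, map_smul]

/-- The explicit solution of `(-S^× + z) ψ = φ`, `A_T ψ = φ` for `z ∈ ϱ(H)`. -/
theorem exists_gamma_of_isInvATG (hR : IsSelfAdjoint R) (hinj : Function.Injective R) {z : ℂ}
    (hz : z ∈ res R l) {K : F →L[ℂ] F} (hK : IsInvATG R B l T z K) (φ : F) :
    ∃ d : F × T.domain, traceT B T d = φ ∧ action R B l T d = z • embed R B T d ∧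
      (d.2 : F) = K (φ - adjoint (Gz R B l (starRingEnd ℂ z)) φ) ∧
      embed R B T d = Rz R l z φ + Gz R B l z d.2 := by
  rw [adjoint_Gz_conj]
  set e : F := Ring.inverse (W R l z) φ with he
  obtain ⟨x, hx⟩ : ∃ x, x = φ - B e := ⟨_, rfl⟩
  rw [← hx]
  have hT := hK.2.1 x (hK.1 x)
  rw [SigmaOf_Gz_sub hR hinj hz, sub_eq_iff_eq_add] at hT
  have hG := Gz_add (B := B) hR (conj_mem_res hR hz) (K x)
  have hW := inverse_W_add hz φ
  rw [← he] at hW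
  have htr : traceT B T (e - (z - l) • Gz R B l z (K x), ⟨K x, hK.1 x⟩) = φ := by
    rw [traceT_apply]
    simp only [hT, map_sub, map_smul]
    rw [hx]
    abel
  have hemb : embed R B T (e - (z - l) • Gz R B l z (K x), ⟨K x, hK.1 x⟩) =
      R e + Gz R B l z (K x) := by
    rw [embed_apply]
    simp only [map_sub, map_smul]
    rw [← hG]
    abel
  refine ⟨(e - (z - l) • Gz R B l z (K x), ⟨K x, hK.1 x⟩), htr, ?_, rfl, hemb⟩
  have hact : ∀ d, action R B l T d = (l : ℂ) • embed R B T d - d.1 + traceT B T d :=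
    fun d => rfl
  rw [hact, hemb, htr]
  conv_lhs => rw [← hW]
  module

end Coordinates

/-- If `Σ̂ Ĝ_{z₀}` has a bounded inverse for some `z₀ ∈ ϱ(H_T)`, then
`Ĥ_T := S^×_T` is self-adjoint, `dom Ĥ_T = {ψ ∈ dom T : ψ - G ψ ∈ 𝔥₁}`,
`dom H ∩ dom Ĥ_T = {0}`; moreover `Σ̂ Ĝ_z` has a bounded inverse for every
`z ∈ ϱ(H_T) ∩ ϱ(Ĥ_T)`, with `(-Ĥ_T + z)⁻¹ = (-H_T + z)⁻¹ - Ĝ_z (Σ̂ Ĝ_z)⁻¹ Ĝ_z̄*`, and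
for `z ∈ ϱ(H) ∩ ϱ(H_T) ∩ ϱ(Ĥ_T)` the block operator matrix
`[[A_T G_z, G_z̄* - 1], [G_z - 1, R_z]]` (domain `dom T ⊕ 𝔉`) has a bounded inverse `𝕄`
and `(-Ĥ_T + z)⁻¹ = R_z - [G_z, R_z] 𝕄 [G_z̄*; R_z]`. -/
theorem statement15
    (R B : F →L[ℂ] F) (l : ℝ)
    (hR : IsSelfAdjoint R) (hinj : Function.Injective ⇑R)
    (hkerG : Function.Injective ⇑(Gz R B l l))
    (hranG : Set.range ⇑(Gz R B l l) ∩ Set.range ⇑R = {0})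
    (T : F →ₗ.[ℂ] F) (hT : IsSelfAdjoint T)
    (HT : F →ₗ.[ℂ] F) (hHTsa : IsSelfAdjoint HT)
    (hHTdom : (HT.domain : Set F)
      = {ψ | ∃ (φ : F) (h : ψ - Gz R B l l φ ∈ Set.range ⇑R) (hφ : φ ∈ T.domain),
          SigmaOf R B (ψ - Gz R B l l φ) + T ⟨φ, hφ⟩ = 0})
    (hHTact : ∀ (ψ : HT.domain) (φ : F),
      (ψ : F) - Gz R B l l φ ∈ Set.range ⇑R →
      HT ψ = (l : ℂ) • (ψ : F) - Hinv R ((ψ : F) - Gz R B l l φ))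
    (hZeq : ∀ z : ℂ, z ∈ res R l ∩ pres HT ↔
      (z ∈ res R l ∧ ∃ K : F →L[ℂ] F, IsInvATG R B l T z K))
    (hZne : (res R l ∩ pres HT).Nonempty)
    (hHTres : ∀ z ∈ res R l ∩ pres HT, ∀ K : F →L[ℂ] F, IsInvATG R B l T z K →
      IsResolventAt HT z
        (Rz R l z - Gz R B l z ∘L K ∘L adjoint (Gz R B l (starRingEnd ℂ z))))
    (Ghat : ℂ → F →L[ℂ] F)
    (hGhat : ∀ z ∈ pres HT, ∀ Q : F →L[ℂ] F,
      IsResolventAt HT (starRingEnd ℂ z) Q →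
      ∀ φ ψ : F, ⟪Ghat z φ, ψ⟫ = ⟪φ, SigmaHat R B l (Q ψ)⟫)
    (z0 : ℂ) (hz0 : z0 ∈ pres HT)
    (V0 : F →L[ℂ] F)
    (hV0 : (∀ ψ : F, V0 (SigmaHat R B l (Ghat z0 ψ)) = ψ) ∧
      (∀ ψ : F, SigmaHat R B l (Ghat z0 (V0 ψ)) = ψ)) :
    ∃ Hhat : F →ₗ.[ℂ] F,
      IsSelfAdjoint Hhat ∧
      (Hhat.domain : Set F)
        = {ψ | ψ ∈ T.domain ∧ ψ - Gz R B l l ψ ∈ Set.range ⇑R} ∧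
      (∀ (ψ : Hhat.domain) (hψT : (ψ : F) ∈ T.domain) (χ : F),
        (ψ : F) - Gz R B l l (ψ : F) = R χ →
        Hhat ψ = (l : ℂ) • (ψ : F) - χ + B χ + T ⟨(ψ : F), hψT⟩) ∧
      Set.range ⇑R ∩ (Hhat.domain : Set F) = {0} ∧
      (∀ z ∈ pres HT ∩ pres Hhat,
        (∃ V : F →L[ℂ] F, (∀ ψ : F, V (SigmaHat R B l (Ghat z ψ)) = ψ) ∧
          (∀ ψ : F, SigmaHat R B l (Ghat z (V ψ)) = ψ)) ∧
        (∀ QT V : F →L[ℂ] F, IsResolventAt HT z QT →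
          ((∀ ψ : F, V (SigmaHat R B l (Ghat z ψ)) = ψ) ∧
            (∀ ψ : F, SigmaHat R B l (Ghat z (V ψ)) = ψ)) →
          IsResolventAt Hhat z
            (QT - Ghat z ∘L V ∘L adjoint (Ghat (starRingEnd ℂ z))))) ∧
      (∀ z : ℂ, z ∈ res R l → z ∈ pres HT → z ∈ pres Hhat →
        ∀ K : F →L[ℂ] F, IsInvATG R B l T z K →
        ∃ M : F × F →L[ℂ] F × F,
          ((∀ p : F × F, (M p).1 ∈ T.domain) ∧
           (∀ (p : F × F) (hp : (M p).1 ∈ T.domain),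
             (T ⟨(M p).1, hp⟩ - SigmaOf R B ((Gz R B l l - Gz R B l z) (M p).1)
                 + (adjoint (Gz R B l (starRingEnd ℂ z)) (M p).2 - (M p).2),
               Gz R B l z (M p).1 - (M p).1 + Rz R l z (M p).2) = p) ∧
           (∀ (u v : F) (hu : u ∈ T.domain),
             M (T ⟨u, hu⟩ - SigmaOf R B ((Gz R B l l - Gz R B l z) u)
                 + (adjoint (Gz R B l (starRingEnd ℂ z)) v - v),
               Gz R B l z u - u + Rz R l z v) = (u, v))) ∧
          (∀ Qh : F →L[ℂ] F, IsResolventAt Hhat z Qh → ∀ ψ : F,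
            Qh ψ = Rz R l z ψ
              - (Gz R B l z
                  (M (adjoint (Gz R B l (starRingEnd ℂ z)) ψ, Rz R l z ψ)).1
                + Rz R l z
                  (M (adjoint (Gz R B l (starRingEnd ℂ z)) ψ, Rz R l z ψ)).2))) := by
  have hGs : Gz R B l l = adjoint B := Gz_self
  rw [hGs] at hkerG hranG
  have hι : Function.Injective (embed R B T) := embed_injective hinj hkerG hranG
  have hσ : ∀ d, SigmaHat R B l (embed R B T d) = traceHat R B T d :=
    SigmaHat_embed hkerG hranG
  have green := green_identity (B := B) (l := l) hR hT
  have ht : IsRestriction (embed R B T) (action R B l T) (traceT B T) HT := by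
    have hmem : ∀ x, x ∈ HT.domain ↔ ∃ d, traceT B T d = 0 ∧ embed R B T d = x := by
      intro x
      rw [← SetLike.mem_coe, hHTdom, Set.mem_ofPred_eq, hGs]
      constructor
      · rintro ⟨φ, ⟨χ, hχ⟩, hφ, h⟩
        rw [← hχ, SigmaOf, Hinv_apply hinj] at h
        exact ⟨(χ, ⟨φ, hφ⟩), h, by rw [embed_apply, hχ, sub_add_cancel]⟩
      · rintro ⟨d, hd, rfl⟩
        have h : embed R B T d - adjoint B d.2 = R d.1 := by simp
        refine ⟨d.2, ⟨d.1, h.symm⟩, d.2.2, ?_⟩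
        rw [h, SigmaOf, Hinv_apply hinj]
        exact hd
    refine ⟨hmem, fun d h hd => ?_⟩
    have h' : embed R B T d - adjoint B d.2 = R d.1 := by simp
    have h'' := hHTact ⟨_, h⟩ d.2
    simp only [hGs, h'] at h''
    rw [h'' ⟨_, rfl⟩, Hinv_apply hinj]
    change _ = (l : ℂ) • embed R B T d - d.1 + traceT B T d
    rw [hd, add_zero]
  have hlift : ∀ z ∈ pres HT, ∀ φ d, traceT B T d = φ →
      action R B l T d = z • embed R B T d → embed R B T d = Ghat z φ := by
    intro z hz φ d ha hL
    obtain ⟨P, hP⟩ := conj_mem_pres hHTsa hz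
    exact eq_gammaField green hσ ht hP (hGhat z hz P hP) ha hL
  have hγ : ∀ z ∈ pres HT, IsGammaField (embed R B T) (action R B l T) (traceT B T) z (Ghat z) := by
    obtain ⟨w, hw⟩ := hZne
    obtain ⟨K, hK⟩ := ((hZeq w).1 hw).2
    have hγw : IsGammaField (embed R B T) (action R B l T) (traceT B T) w (Ghat w) := by
      intro φ
      obtain ⟨d, ha, hL, -, -⟩ := exists_gamma_of_isInvATG hR hinj hw.1 hK φ
      exact ⟨d, ha, hL, hlift w hw.2 φ d ha hL⟩
    rintro z ⟨Q, hQ⟩ φ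
    obtain ⟨d, ha, hL⟩ := exists_solution_of_gammaField ht hγw hQ φ
    exact ⟨d, ha, hL, hlift z ⟨Q, hQ⟩ φ d ha hL⟩
  have hadj : ∀ z ∈ pres HT, ∀ Q : F →L[ℂ] F, IsResolventAt HT z Q → ∀ ψ,
      adjoint (Ghat (starRingEnd ℂ z)) ψ = SigmaHat R B l (Q ψ) := by
    intro z hz Q hQ ψ
    refine ext_inner_left ℂ fun φ => ?_
    rw [adjoint_inner_right]
    exact hGhat _ (conj_mem_pres hHTsa hz) Q (by rwa [Complex.conj_conj]) φ ψ
  have hcomm : ∀ z ∈ pres HT, ∀ φ φ', ⟪SigmaHat R B l (Ghat z φ), φ'⟫ =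
      ⟪φ, SigmaHat R B l (Ghat (starRingEnd ℂ z) φ')⟫ := fun z hz =>
    inner_gammaField_comm green hσ (hγ z hz) (hγ _ (conj_mem_pres hHTsa hz))
  obtain ⟨Hhat, hh⟩ := exists_isRestriction hι (action R B l T) (traceHat R B T)
  have hkrein : ∀ z ∈ pres HT, ∀ Q V : F →L[ℂ] F, IsResolventAt HT z Q →
      ((∀ ψ, V (SigmaHat R B l (Ghat z ψ)) = ψ) ∧ ∀ ψ, SigmaHat R B l (Ghat z (V ψ)) = ψ) →
      IsResolventAt Hhat z (Q - Ghat z ∘L V ∘L adjoint (Ghat (starRingEnd ℂ z))) :=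
    fun z hz Q V hQ hV =>
      krein_isResolventAt ht hh hσ (hγ z hz) hQ hV.1 hV.2 (hadj z hz Q hQ)
  have hsym : ∀ x y : Hhat.domain, ⟪Hhat x, (y : F)⟫ = ⟪(x : F), Hhat y⟫ := by
    rintro ⟨x, hx⟩ ⟨y, hy⟩
    obtain ⟨d, hd, rfl⟩ := (hh.mem_iff x).1 hx
    obtain ⟨e, he, rfl⟩ := (hh.mem_iff y).1 hy
    have h := green d e
    rw [hd, he, inner_zero_left, inner_zero_right, sub_self, sub_eq_zero] at h
    rw [hh.apply_eq d hx hd, hh.apply_eq e hy he]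
    exact h
  have hHhatsa : IsSelfAdjoint Hhat := by
    obtain ⟨Q₀, hQ₀⟩ := hz0
    have hc := hcomm z0 ⟨Q₀, hQ₀⟩
    refine isSelfAdjoint_of_symmetric_of_isResolventAt hsym
      (hkrein z0 ⟨Q₀, hQ₀⟩ Q₀ V0 hQ₀ hV0)
      (hkrein _ (conj_mem_pres hHTsa ⟨Q₀, hQ₀⟩) _ (adjoint V0) (hQ₀.conj_adjoint hHTsa)
        ⟨fun ψ => ext_inner_left ℂ fun y => ?_, fun ψ => ext_inner_left ℂ fun y => ?_⟩)
    · rw [adjoint_inner_right, ← hc, hV0.2]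
    · rw [← hc, adjoint_inner_right, hV0.1]
  have hsurj : Function.Surjective (traceHat R B T) := by
    intro y
    obtain ⟨d, -, -, hi⟩ := hγ z0 hz0 (V0 y)
    exact ⟨d, by rw [← hσ, hi, hV0.2]⟩
  have hbij : ∀ z ∈ pres HT, z ∈ pres Hhat →
      Function.Bijective fun φ => SigmaHat R B l (Ghat z φ) := by
    rintro z ⟨P, hP⟩ ⟨Q, hQ⟩
    exact bijective_gammaField ht hh hι hσ (hγ z ⟨P, hP⟩) hsurj hP hQ
  have hinv : ∀ z ∈ pres HT, z ∈ pres Hhat → ∃ V : F →L[ℂ] F,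
      (∀ ψ, V (SigmaHat R B l (Ghat z ψ)) = ψ) ∧ ∀ ψ, SigmaHat R B l (Ghat z (V ψ)) = ψ := by
    intro z hz hz'
    have hb := hbij z hz hz'
    choose v hv using hb.2
    choose v' hv' using
      (hbij _ (conj_mem_pres hHTsa hz) (conj_mem_pres hHhatsa hz')).2
    simp only at hv hv'
    obtain ⟨V, hV⟩ := exists_clm_of_formalAdjoint (f := v) (g := v') fun x y => by
      conv_lhs => rw [← hv' y]
      rw [← hcomm z hz, hv]
    refine ⟨V, fun ψ => hb.1 ?_, fun ψ => ?_⟩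
    · simp only
      rw [hV, hv]
    · rw [hV, hv]
  refine ⟨Hhat, hHhatsa, ?_, ?_, ?_, fun z hz => ⟨hinv z hz.1 hz.2, hkrein z hz.1⟩, ?_⟩
  · ext ψ
    rw [SetLike.mem_coe, hh.mem_iff, Set.mem_ofPred_eq, hGs]
    constructor
    · rintro ⟨d, hd, rfl⟩
      have hd' : embed R B T d = d.2 := by
        rw [← sub_eq_zero]
        exact hd
      have h : embed R B T d - adjoint B d.2 = R d.1 := by simp
      rw [hd'] at h ⊢
      exact ⟨d.2.2, d.1, h.symm⟩
    · rintro ⟨hψ, χ, hχ⟩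
      refine ⟨(χ, ⟨ψ, hψ⟩), ?_, ?_⟩ <;> simp [hχ]
  · intro ψ hψT χ hχ
    obtain ⟨ψ, hψ⟩ := ψ
    simp only [hGs] at hχ hψT ⊢
    have hd : embed R B T (χ, ⟨ψ, hψT⟩) = ψ := by rw [embed_apply, ← hχ, sub_add_cancel]
    have hs : traceHat R B T (χ, ⟨ψ, hψT⟩) = 0 := by
      rw [← sub_eq_zero] at hd
      exact hd
    have hval := hh.apply_eq (χ, ⟨ψ, hψT⟩) (by rw [hd]; exact hψ) hs
    simp only [hd] at hval
    rw [hval]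
    change (l : ℂ) • embed R B T (χ, ⟨ψ, hψT⟩) - χ + (B χ + T ⟨ψ, hψT⟩) = _
    rw [hd, add_assoc]
  · refine Set.eq_singleton_iff_unique_mem.2 ⟨⟨⟨0, map_zero R⟩, Hhat.domain.zero_mem⟩, ?_⟩
    rintro ψ ⟨hψ, hψ'⟩
    obtain ⟨d, hd, rfl⟩ := (hh.mem_iff ψ).1 hψ'
    have hd' : embed R B T d = d.2 := by
      rw [← sub_eq_zero]
      exact hd
    rw [hd']
    refine eq_of_sub_mem_range (ψ := embed R B T d) hkerG hranG ⟨d.1, by simp⟩ ?_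
    rwa [map_zero, sub_zero]
  · intro z hzR hzT hzh K hK
    obtain ⟨V, hV₁, hV₂⟩ := hinv z hzT hzh
    set Gs : F →L[ℂ] F := adjoint (Gz R B l (starRingEnd ℂ z))
    have hGh : ∀ v, Ghat z v = Rz R l z v + Gz R B l z (K (v - Gs v)) ∧
        SigmaHat R B l (Ghat z v) =
          Rz R l z v + Gz R B l z (K (v - Gs v)) - K (v - Gs v) := by
      intro v
      obtain ⟨d, ha, hL, h₂, hi⟩ := exists_gamma_of_isInvATG hR hinj hzR hK v
      rw [← hlift z hzT v d ha hL, hσ, ← h₂, ← hi]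
      exact ⟨rfl, rfl⟩
    let vM : F × F →L[ℂ] F := V ∘L
      (ContinuousLinearMap.snd ℂ F F - (Gz R B l z - 1) ∘L K ∘L ContinuousLinearMap.fst ℂ F F)
    let M : F × F →L[ℂ] F × F :=
      (K ∘L (ContinuousLinearMap.fst ℂ F F + (1 - Gs) ∘L vM)).prod vM
    have hM₂ : ∀ p, (M p).2 = V (p.2 - (Gz R B l z (K p.1) - K p.1)) := fun p => rfl
    have hM₁ : ∀ p, (M p).1 = K (p.1 + ((M p).2 - Gs (M p).2)) := fun p => rfl
    refine ⟨M, ⟨fun p => ?_, fun p hp => ?_, fun u v hu => ?_⟩, fun Qh hQh ψ => ?_⟩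
    · rw [hM₁]
      exact hK.1 _
    · have hΓ := hV₂ (p.2 - (Gz R B l z (K p.1) - K p.1))
      rw [← hM₂, (hGh _).2] at hΓ
      refine Prod.ext ?_ ?_
      · have h := hK.2.1 _ (hK.1 (p.1 + ((M p).2 - Gs (M p).2)))
        simp only [← hM₁] at h
        simp only [h]
        abel
      · simp only
        rw [hM₁, map_add K, map_add, ← sub_eq_zero]
        rw [← sub_eq_zero] at hΓ
        rw [← hΓ]
        abel
    · have hKu := hK.2.2 ⟨u, hu⟩
      simp only at hKu
      set x := T ⟨u, hu⟩ - SigmaOf R B ((Gz R B l l - Gz R B l z) u)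
      have hKx : K (x + (Gs v - v)) = u - K (v - Gs v) := by
        rw [map_add, hKu, ← neg_sub v, map_neg, ← sub_eq_add_neg]
      have h₂ : (M (x + (Gs v - v), Gz R B l z u - u + Rz R l z v)).2 = v := by
        rw [hM₂]
        simp only
        rw [hKx]
        conv_rhs => rw [← hV₁ v, (hGh v).2]
        congr 1
        rw [map_sub]
        abel
      refine Prod.ext ?_ h₂
      rw [hM₁, h₂]
      simp only
      rw [← hKu]
      congr 1
      abel
    · have hQT := hHTres z ⟨hzR, hzT⟩ K hK
      have hC : SigmaHat R B l
          ((Rz R l z - Gz R B l z ∘L K ∘L Gs) ψ) =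
          Rz R l z ψ - (Gz R B l z (K (Gs ψ)) - K (Gs ψ)) := by
        have h : (Rz R l z - Gz R B l z ∘L K ∘L Gs) ψ =
            R (Ring.inverse (W R l z) ψ + (z - l) • Gz R B l z (K (Gs ψ))) +
              adjoint B (-K (Gs ψ)) := by
          rw [map_neg, ← Gz_add (B := B) hR (conj_mem_res hR hzR) (K (Gs ψ)), map_add, map_smul]
          change R (Ring.inverse (W R l z) ψ) - Gz R B l z (K (Gs ψ)) = _
          abel
        rw [h, SigmaHat_add hkerG hranG, ← h]
        change Rz R l z ψ - Gz R B l z (K (Gs ψ)) - _ = _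
        abel
      have hv : (M (Gs ψ, Rz R l z ψ)).2 =
          V (adjoint (Ghat (starRingEnd ℂ z)) ψ) := by
        rw [hadj z hzT _ hQT, hC, hM₂]
      rw [hQh.eq (hkrein z hzT _ V hQT ⟨hV₁, hV₂⟩), hM₁]
      simp only
      set v := (M (Gs ψ, Rz R l z ψ)).2
      change Rz R l z ψ - Gz R B l z (K (Gs ψ)) -
        Ghat z (V (adjoint (Ghat (starRingEnd ℂ z)) ψ)) = _
      rw [← hv, (hGh v).1, map_add K, map_add]
      abel
end
end

section
/- Let B ∈ B(𝔉) be such that 1 − B has a bounded inverse in B(𝔉) (then so does 1 − B*). Define the operator K by dom(K) := {ψ ∈ 𝔉 : ψ − Bψ ∈ dom(H)} and Kψ := λ₀ψ − (1 − B*)(−H + λ₀)(1 − B)ψ. Then K is self-adjoint, λ₀ ∈ ϱ(K), and (−K + λ₀)⁻¹ = (1 − B)⁻¹(−H + λ₀)⁻¹(1 − B*)⁻¹. If moreover λ₀ < inf σ(H), then K ≥ λ₀ (in particular K is bounded from below). -/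
noncomputable section

open scoped ComplexInnerProductSpace
open ContinuousLinearMap Filter

variable {F X : Type*}
  [NormedAddCommGroup F] [InnerProductSpace ℂ F] [CompleteSpace F]
  [NormedAddCommGroup X] [InnerProductSpace ℂ X] [CompleteSpace X]

section ResolventInverse

variable {E : Type*} [NormedAddCommGroup E] [InnerProductSpace ℂ E]
  (Q : E →L[ℂ] E) (hinj : Function.Injective ⇑Q) (l : ℝ)

/-- The operator with domain `ran Q` and resolvent `Q` at `l`, i.e. `l - Q⁻¹`. -/
def ofResolvent : E →ₗ.[ℂ] E where
  domain := LinearMap.range (Q : E →ₗ[ℂ] E)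
  toFun := (l : ℂ) • (LinearMap.range (Q : E →ₗ[ℂ] E)).subtype -
    (LinearEquiv.ofInjective (Q : E →ₗ[ℂ] E) hinj).symm.toLinearMap

theorem mem_ofResolvent_domain {ψ : E} : ψ ∈ (ofResolvent Q hinj l).domain ↔ ∃ φ, Q φ = ψ :=
  Iff.rfl

theorem ofResolvent_apply (ψ : (ofResolvent Q hinj l).domain) (φ : E) (h : (ψ : E) = Q φ) :
    ofResolvent Q hinj l ψ = (l : ℂ) • (ψ : E) - φ := by
  have hs : (LinearEquiv.ofInjective (Q : E →ₗ[ℂ] E) hinj).symm ψ = φ :=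
    (LinearEquiv.symm_apply_eq _).2 (Subtype.ext h)
  change (l : ℂ) • (ψ : E) - (LinearEquiv.ofInjective (Q : E →ₗ[ℂ] E) hinj).symm ψ = _
  rw [hs]

theorem isResolventAt_ofResolvent : IsResolventAt (ofResolvent Q hinj l) (l : ℂ) Q := by
  refine ⟨fun ψ => ⟨ψ, rfl⟩, fun ψ h => ?_, fun ψ => ?_⟩
  · rw [ofResolvent_apply Q hinj l ⟨Q ψ, h⟩ ψ rfl, sub_sub_cancel]
  · obtain ⟨φ, hφ⟩ := (mem_ofResolvent_domain Q hinj l).1 ψ.2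
    rw [ofResolvent_apply Q hinj l ψ φ hφ.symm, sub_sub_cancel, hφ]

variable {Q} [CompleteSpace E]

theorem inner_apply_left_of_isSelfAdjoint (hQ : IsSelfAdjoint Q) (x y : E) :
    ⟪Q x, y⟫ = ⟪x, Q y⟫ :=
  hQ.isSymmetric x y

theorem dense_range_of_isSelfAdjoint_of_injective (hQ : IsSelfAdjoint Q)
    (hinj : Function.Injective ⇑Q) :
    Dense (LinearMap.range (Q : E →ₗ[ℂ] E) : Set E) := by
  rw [Submodule.dense_iff_topologicalClosure_eq_top,
    Submodule.topologicalClosure_eq_top_iff, Submodule.eq_bot_iff]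
  intro x hx
  refine hinj ?_
  rw [map_zero]
  refine ext_inner_left ℂ fun v => ?_
  rw [← inner_apply_left_of_isSelfAdjoint hQ, inner_zero_right]
  exact hx (Q v) ⟨v, rfl⟩

theorem isSelfAdjoint_ofResolvent (hQ : IsSelfAdjoint Q) :
    IsSelfAdjoint (ofResolvent Q hinj l) := by
  have hdense : Dense ((ofResolvent Q hinj l).domain : Set E) :=
    dense_range_of_isSelfAdjoint_of_injective hQ hinj
  have hformal : (ofResolvent Q hinj l).IsFormalAdjoint (ofResolvent Q hinj l) := by
    intro x y
    obtain ⟨a, ha⟩ := (mem_ofResolvent_domain Q hinj l).1 x.2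
    obtain ⟨b, hb⟩ := (mem_ofResolvent_domain Q hinj l).1 y.2
    rw [ofResolvent_apply Q hinj l x a ha.symm, ofResolvent_apply Q hinj l y b hb.symm,
      inner_sub_left, inner_sub_right, inner_smul_left, inner_smul_right, Complex.conj_ofReal,
      ← ha, ← hb, inner_apply_left_of_isSelfAdjoint hQ a b]
  have hle := hformal.le_adjoint hdense
  rw [LinearPMap.isSelfAdjoint_def]
  refine (LinearPMap.eq_of_le_of_domain_eq hle (le_antisymm hle.1 fun y hy => ?_)).symm
  refine (mem_ofResolvent_domain Q hinj l).2
    ⟨(l : ℂ) • y - (ofResolvent Q hinj l).adjoint ⟨y, hy⟩, ?_⟩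
  refine ext_inner_right ℂ fun v => ?_
  have hv := LinearPMap.adjoint_isFormalAdjoint hdense ⟨y, hy⟩ ⟨Q v, v, rfl⟩
  rw [ofResolvent_apply Q hinj l ⟨Q v, v, rfl⟩ v rfl, inner_sub_right, inner_smul_right] at hv
  rw [inner_apply_left_of_isSelfAdjoint hQ, inner_sub_left, inner_smul_left, Complex.conj_ofReal,
    hv, sub_sub_cancel]

end ResolventInverse

/-- Let `Bop ∈ B(𝔉)` with `1 - Bop` boundedly invertible (then so is
`1 - Bop*`).  The operator `K` with `dom K = {ψ : ψ - Bop ψ ∈ dom H}` and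
`K ψ := λ₀ ψ - (1 - Bop*)(-H + λ₀)(1 - Bop) ψ` is self-adjoint, `λ₀ ∈ ϱ(K)` and
`(-K + λ₀)⁻¹ = (1 - Bop)⁻¹ (-H + λ₀)⁻¹ (1 - Bop*)⁻¹`.  If moreover `λ₀ < inf σ(H)`
(i.e. `H ≥ λ₀ + δ` for some `δ > 0`) then `K ≥ λ₀`. -/
theorem statement17
    (R : F →L[ℂ] F) (l : ℝ)
    (hR : IsSelfAdjoint R) (hinj : Function.Injective ⇑R)
    (Bop : F →L[ℂ] F) (hB : IsUnit (1 - Bop)) :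
    IsUnit (1 - adjoint Bop) ∧
    ∃ K : F →ₗ.[ℂ] F,
      (K.domain : Set F) = {ψ | ψ - Bop ψ ∈ Set.range ⇑R} ∧
      (∀ (ψ : K.domain) (χ : F), (ψ : F) - Bop (ψ : F) = R χ →
        K ψ = (l : ℂ) • (ψ : F) - (χ - adjoint Bop χ)) ∧
      IsSelfAdjoint K ∧
      IsResolventAt K (l : ℂ)
        (Ring.inverse (1 - Bop) ∘L R ∘L Ring.inverse (1 - adjoint Bop)) ∧
      ((∃ δ : ℝ, 0 < δ ∧
          ∀ χ : F, (l + δ) * ‖R χ‖ ^ 2 ≤ (⟪R χ, (l : ℂ) • R χ - χ⟫).re) →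
        ∀ ψ : K.domain, l * ‖(ψ : F)‖ ^ 2 ≤ (⟪(ψ : F), K ψ⟫).re) := by
  obtain ⟨u, hu⟩ := hB
  have hadj : 1 - adjoint Bop = ((star u : (F →L[ℂ] F)ˣ) : F →L[ℂ] F) := by
    rw [Units.coe_star, hu, star_sub, star_one, star_eq_adjoint]
  have hsub (ψ : F) : ψ - Bop ψ = (u : F →L[ℂ] F) ψ := by simp [hu]
  have hsub' (χ : F) : χ - adjoint Bop χ = ((star u : (F →L[ℂ] F)ˣ) : F →L[ℂ] F) χ := by
    simp [← hadj]
  have cancel (v : (F →L[ℂ] F)ˣ) (x : F) :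
      (v : F →L[ℂ] F) ((↑v⁻¹ : F →L[ℂ] F) x) = x := by
    rw [← mul_apply_eq_comp, Units.mul_inv, one_apply_eq_self]
  have cancel' (v : (F →L[ℂ] F)ˣ) (x : F) :
      (↑v⁻¹ : F →L[ℂ] F) ((v : F →L[ℂ] F) x) = x := by
    rw [← mul_apply_eq_comp, Units.inv_mul, one_apply_eq_self]
  rw [hadj, ← hu, Ring.inverse_unit, Ring.inverse_unit]
  set Q : F →L[ℂ] F := (↑u⁻¹ : F →L[ℂ] F) ∘L R ∘L (↑(star u)⁻¹ : F →L[ℂ] F) with hQdef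
  have hQ : IsSelfAdjoint Q := by
    have h := hR.conjugate (↑u⁻¹ : F →L[ℂ] F)
    rwa [← Units.coe_star, star_inv, mul_assoc] at h
  have hQinj : Function.Injective ⇑Q :=
    (Function.LeftInverse.injective (f := ⇑(↑u⁻¹ : F →L[ℂ] F)) (cancel u)).comp
      (hinj.comp (Function.LeftInverse.injective (f := ⇑(↑(star u)⁻¹ : F →L[ℂ] F))
        (cancel (star u))))
  have hQ_iff (ψ χ : F) :
      (u : F →L[ℂ] F) ψ = R χ ↔ ψ = Q (((star u : (F →L[ℂ] F)ˣ) : F →L[ℂ] F) χ) := by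
    simp only [hQdef, ContinuousLinearMap.comp_apply, cancel']
    exact ⟨fun h => by rw [← h, cancel'], fun h => by rw [h, cancel]⟩
  have hK (ψ : (ofResolvent Q hQinj l).domain) (χ : F) (h : (ψ : F) - Bop (ψ : F) = R χ) :
      ofResolvent Q hQinj l ψ = (l : ℂ) • (ψ : F) - (χ - adjoint Bop χ) := by
    rw [hsub, hQ_iff] at h
    rw [ofResolvent_apply Q hQinj l ψ _ h, hsub']
  have hdom : ((ofResolvent Q hQinj l).domain : Set F) = {ψ | ψ - Bop ψ ∈ Set.range ⇑R} := by
    ext ψ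
    constructor
    · rintro ⟨φ, hφ⟩
      refine ⟨(↑(star u)⁻¹ : F →L[ℂ] F) φ, ?_⟩
      rw [hsub, eq_comm, hQ_iff, cancel]
      exact hφ.symm
    · rintro ⟨χ, hχ⟩
      rw [hsub, eq_comm, hQ_iff] at hχ
      exact ⟨_, hχ.symm⟩
  refine ⟨(star u).isUnit, ofResolvent Q hQinj l, hdom, hK,
    isSelfAdjoint_ofResolvent hQinj l hQ, isResolventAt_ofResolvent Q hQinj l, ?_⟩
  rintro ⟨δ, hδ, hlow⟩ ψ
  obtain ⟨χ, hχ⟩ : (ψ : F) - Bop (ψ : F) ∈ Set.range ⇑R := hdom.subset ψ.2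
  have hself (x : F) : (⟪x, (l : ℂ) • x⟫).re = l * ‖x‖ ^ 2 := by
    rw [inner_smul_right, inner_self_eq_norm_sq_to_K, Complex.re_ofReal_mul]
    norm_cast
  have hneg := hlow χ
  have hnn : 0 ≤ δ * ‖R χ‖ ^ 2 := by positivity
  rw [inner_sub_right, Complex.sub_re, hself] at hneg
  rw [hK ψ χ hχ.symm, inner_sub_right, Complex.sub_re, hself, inner_sub_right,
    adjoint_inner_right, ← inner_sub_left, ← hχ]
  linarith
end
end
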